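/- arXiv:2103.13221 — 4 statements merged into one kernel-verified Lean document; each statement's English description precedes it below -/
import Mathlib

section
/- Let J ≥ 1, r ≥ 1, p ≥ 1, and let Σ_b and Σ_ε be symmetric positive definite r×r real matrices. Let Σ̃ = (1_J 1_J^T) ⊗ Σ_b + I_J ⊗ Σ_ε ∈ ℝ^{Jr×Jr}. Then for every β ∈ ℝ^{r×p}, the Σ̃-envelope of the column span of 1_J ⊗ β equals the image of the (Σ_ε/J + Σ_b)-envelope of the column span of β under the injective linear map ι : ℝ^r → ℝ^{Jr}, ι(v) = 1_J ⊗ v. (Proposition 1: a basis for E_{Σ̃}(span(1_J⊗β)) is 1_J ⊗ Φ, where Φ is a basis for E_{Σ_ε/J+Σ_b}(span(β)).) -/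
open Matrix Kronecker

/-- A subspace `S` is invariant under the matrix `M` if `M` maps `S` into itself. -/
def Matrix.InvariantSubspace {d : Type*} [Fintype d] (M : Matrix d d ℝ)
    (S : Submodule ℝ (d → ℝ)) : Prop :=
  ∀ v ∈ S, M.mulVec v ∈ S

/-- The `M`-envelope of a subspace `U`: the smallest `M`-invariant subspace containing `U`. -/
noncomputable def Matrix.envelope {d : Type*} [Fintype d] (M : Matrix d d ℝ)
    (U : Submodule ℝ (d → ℝ)) : Submodule ℝ (d → ℝ) :=
  sInf {S | U ≤ S ∧ M.InvariantSubspace S}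

/-- The column span of a matrix. -/
noncomputable def Matrix.colSpan {d p : Type*} (β : Matrix d p ℝ) :
    Submodule ℝ (d → ℝ) :=
  Submodule.span ℝ (Set.range fun j => fun i => β i j)

/-- The injective linear map `ι : ℝ^r → ℝ^{Jr}`, `ι v = 1_J ⊗ v`. -/
def kronOnes (J r : ℕ) : (Fin r → ℝ) →ₗ[ℝ] (Fin J × Fin r → ℝ) where
  toFun v := fun ji => v ji.2
  map_add' _ _ := rfl
  map_smul' _ _ := rfl

theorem kron_mulVec_kronOnes (J r : ℕ) (hJ : 1 ≤ J)
    (Sb Se : Matrix (Fin r) (Fin r) ℝ) (v : Fin r → ℝ) :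
    ((Matrix.of fun _ _ => (1 : ℝ) : Matrix (Fin J) (Fin J) ℝ) ⊗ₖ Sb
        + (1 : Matrix (Fin J) (Fin J) ℝ) ⊗ₖ Se).mulVec (kronOnes J r v) =
      (J : ℝ) • kronOnes J r (((J : ℝ)⁻¹ • Se + Sb).mulVec v) := by
  have hJ0 : (J : ℝ) ≠ 0 := by
    have : J ≠ 0 := by omega
    exact_mod_cast this
  ext ⟨j, i⟩
  have h1 : ((Matrix.of fun _ _ => (1 : ℝ) : Matrix (Fin J) (Fin J) ℝ) ⊗ₖ Sb).mulVec
      (kronOnes J r v) (j, i) = (J : ℝ) * Sb.mulVec v i := by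
    simp [Matrix.mulVec, dotProduct, kronOnes, Fintype.sum_prod_type]
  have h2 : ((1 : Matrix (Fin J) (Fin J) ℝ) ⊗ₖ Se).mulVec
      (kronOnes J r v) (j, i) = Se.mulVec v i := by
    simp only [Matrix.mulVec, dotProduct, kronOnes, Fintype.sum_prod_type,
      Matrix.kroneckerMap_apply, LinearMap.coe_mk, AddHom.coe_mk]
    rw [Finset.sum_eq_single j]
    · simp
    · intro b _ hb
      simp [Matrix.one_apply_ne hb.symm]
    · simp
  rw [Matrix.add_mulVec, Pi.add_apply, h1, h2, Matrix.add_mulVec, Matrix.smul_mulVec]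
  simp only [kronOnes, LinearMap.coe_mk, AddHom.coe_mk, Pi.smul_apply, Pi.add_apply, smul_eq_mul]
  field_simp
  ring

theorem colSpan_kronOnes (J r p : ℕ) (β : Matrix (Fin r) (Fin p) ℝ) :
    Matrix.colSpan
        ((Matrix.of fun _ _ => (1 : ℝ) : Matrix (Fin J) (Fin 1) ℝ) ⊗ₖ β) =
      Submodule.map (kronOnes J r) (Matrix.colSpan β) := by
  unfold Matrix.colSpan
  rw [Submodule.map_span]
  congr 1
  ext x
  constructor
  · rintro ⟨⟨a, k⟩, rfl⟩
    refine ⟨_, ⟨k, rfl⟩, ?_⟩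
    ext ⟨j, i⟩
    simp [kronOnes]
  · rintro ⟨_, ⟨k, rfl⟩, rfl⟩
    refine ⟨(0, k), ?_⟩
    ext ⟨j, i⟩
    simp [kronOnes]

/-- **Proposition 1.** With `Σ̃ = (1_J 1_J^T) ⊗ Σ_b + I_J ⊗ Σ_ε`, the `Σ̃`-envelope of the
column span of `1_J ⊗ β` is the image under `ι : v ↦ 1_J ⊗ v` of the
`(Σ_ε/J + Σ_b)`-envelope of the column span of `β`. -/
theorem envelope_kronecker_ones
    (J r p : ℕ) (hJ : 1 ≤ J) (hr : 1 ≤ r) (hp : 1 ≤ p)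
    (Sb Se : Matrix (Fin r) (Fin r) ℝ) (hSb : Sb.PosDef) (hSe : Se.PosDef)
    (β : Matrix (Fin r) (Fin p) ℝ) :
    Matrix.envelope
      ((Matrix.of fun _ _ => (1 : ℝ) : Matrix (Fin J) (Fin J) ℝ) ⊗ₖ Sb
        + (1 : Matrix (Fin J) (Fin J) ℝ) ⊗ₖ Se)
      (Matrix.colSpan
        ((Matrix.of fun _ _ => (1 : ℝ) : Matrix (Fin J) (Fin 1) ℝ) ⊗ₖ β)) =
    Submodule.map (kronOnes J r)
      (Matrix.envelope ((J : ℝ)⁻¹ • Se + Sb) (Matrix.colSpan β)) := by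
  rw [colSpan_kronOnes]
  have hJ0 : (J : ℝ) ≠ 0 := by
    have : J ≠ 0 := by omega
    exact_mod_cast this
  have key := kron_mulVec_kronOnes J r hJ Sb Se
  apply le_antisymm
  · refine sInf_le ⟨Submodule.map_mono (le_sInf fun S hS => hS.1), ?_⟩
    rintro _ ⟨v, hv, rfl⟩
    rw [key]
    refine Submodule.smul_mem _ _ (Submodule.mem_map_of_mem ?_)
    refine Submodule.mem_sInf.2 fun S hS => hS.2 v ?_
    exact Submodule.mem_sInf.1 hv S hS
  · refine le_sInf fun S hS => ?_
    rw [Submodule.map_le_iff_le_comap]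
    refine sInf_le ⟨Submodule.map_le_iff_le_comap.1 hS.1, fun v hv => ?_⟩
    have h := hS.2 _ hv
    rw [key] at h
    exact (Submodule.smul_mem_iff _ hJ0).1 h
end

section
/- Let J ≥ 1, r ≥ 1, p ≥ 1, and let Σ_b and Σ_ε be symmetric positive definite r×r real matrices. Let Σ̃ = (1_J 1_J^T) ⊗ Σ_b + I_J ⊗ Σ_ε ∈ ℝ^{Jr×Jr}. Then for every β ∈ ℝ^{r×p}, the dimension of the Σ̃-envelope of the column span of 1_J ⊗ β is at most r (Corollary 1: the dimension of E_{Σ̃}(span(1_J⊗β)) ⊆ ℝ^{Jr} cannot exceed r). -/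
open Matrix Kronecker

/-- **Corollary 1.** With `Σ̃ = (1_J 1_J^T) ⊗ Σ_b + I_J ⊗ Σ_ε ∈ ℝ^{Jr×Jr}`, the dimension of the
`Σ̃`-envelope of the column span of `1_J ⊗ β` cannot exceed `r`. -/
theorem finrank_envelope_kronecker_ones_le
    (J r p : ℕ) (hJ : 1 ≤ J) (hr : 1 ≤ r) (hp : 1 ≤ p)
    (Sb Se : Matrix (Fin r) (Fin r) ℝ) (hSb : Sb.PosDef) (hSe : Se.PosDef)
    (β : Matrix (Fin r) (Fin p) ℝ) :
    Module.finrank ℝ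
      (Matrix.envelope
        ((Matrix.of fun _ _ => (1 : ℝ) : Matrix (Fin J) (Fin J) ℝ) ⊗ₖ Sb
          + (1 : Matrix (Fin J) (Fin J) ℝ) ⊗ₖ Se)
        (Matrix.colSpan
          ((Matrix.of fun _ _ => (1 : ℝ) : Matrix (Fin J) (Fin 1) ℝ) ⊗ₖ β))) ≤ r := by
  have hle : Matrix.envelope
        ((Matrix.of fun _ _ => (1 : ℝ) : Matrix (Fin J) (Fin J) ℝ) ⊗ₖ Sb
          + (1 : Matrix (Fin J) (Fin J) ℝ) ⊗ₖ Se)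
        (Matrix.colSpan
          ((Matrix.of fun _ _ => (1 : ℝ) : Matrix (Fin J) (Fin 1) ℝ) ⊗ₖ β)) ≤
      LinearMap.range (LinearMap.funLeft ℝ ℝ (Prod.snd : Fin J × Fin r → Fin r)) := by
    apply sInf_le
    refine ⟨?_, ?_⟩
    · refine Submodule.span_le.2 ?_
      rintro _ ⟨j, rfl⟩
      refine ⟨fun i => β i j.2, ?_⟩
      ext i
      simp [LinearMap.funLeft_apply]
    · rintro _ ⟨v, rfl⟩
      refine ⟨(J : ℝ) • Sb.mulVec v + Se.mulVec v, ?_⟩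
      ext i
      simp [LinearMap.funLeft_apply, Matrix.mulVec, dotProduct,
        Fintype.sum_prod_type, Matrix.one_apply]
      simp only [add_mul, Finset.sum_add_distrib]
      congr 1
      · simp
      · rw [Finset.sum_comm]
        simp
  refine (Submodule.finrank_mono hle).trans ?_
  refine (LinearMap.finrank_range_le _).trans ?_
  simp
end

section
/- Fix integers q ≥ 1, r ≥ 1, J ≥ 2. Let S, S' be symmetric r×r real matrices and T, T' be symmetric (qr)×(qr) real matrices. If for every matrix Z ∈ ℝ^{q×J} one has I_J ⊗ S + (Z^T ⊗ I_r) T (Z ⊗ I_r) = I_J ⊗ S' + (Z^T ⊗ I_r) T' (Z ⊗ I_r) as (Jr)×(Jr) matrices, then S = S' and T = T'. -/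
open Matrix Kronecker

/-- **Identification step in Proposition 4.** If
`I_J ⊗ S + (Zᵀ ⊗ I_r) T (Z ⊗ I_r) = I_J ⊗ S' + (Zᵀ ⊗ I_r) T' (Z ⊗ I_r)` for every
`Z ∈ ℝ^{q×J}` (with `S, S'` symmetric `r×r` and `T, T'` symmetric `(qr)×(qr)`, `J ≥ 2`),
then `S = S'` and `T = T'`. -/
theorem marginal_covariance_identification
    (q r J : ℕ) (hq : 1 ≤ q) (hr : 1 ≤ r) (hJ : 2 ≤ J)
    (S S' : Matrix (Fin r) (Fin r) ℝ) (hS : S.IsSymm) (hS' : S'.IsSymm)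
    (T T' : Matrix (Fin q × Fin r) (Fin q × Fin r) ℝ) (hT : T.IsSymm) (hT' : T'.IsSymm)
    (h : ∀ Z : Matrix (Fin q) (Fin J) ℝ,
      (1 : Matrix (Fin J) (Fin J) ℝ) ⊗ₖ S
          + (Zᵀ ⊗ₖ (1 : Matrix (Fin r) (Fin r) ℝ)) * T * (Z ⊗ₖ (1 : Matrix (Fin r) (Fin r) ℝ))
        = (1 : Matrix (Fin J) (Fin J) ℝ) ⊗ₖ S'
          + (Zᵀ ⊗ₖ (1 : Matrix (Fin r) (Fin r) ℝ)) * T' * (Z ⊗ₖ (1 : Matrix (Fin r) (Fin r) ℝ))) :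
    S = S' ∧ T = T' := by
  have entry : ∀ (U : Matrix (Fin q × Fin r) (Fin q × Fin r) ℝ) (f : Fin J → Fin q)
      (j k : Fin J) (a b : Fin r),
      (((Matrix.of fun i j => if i = f j then (1 : ℝ) else 0 : Matrix (Fin q) (Fin J) ℝ)ᵀ ⊗ₖ
          (1 : Matrix (Fin r) (Fin r) ℝ)) * U *
        ((Matrix.of fun i j => if i = f j then (1 : ℝ) else 0 : Matrix (Fin q) (Fin J) ℝ) ⊗ₖ
          (1 : Matrix (Fin r) (Fin r) ℝ))) (j, a) (k, b) = U (f j, a) (f k, b) := by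
    intro U f j k a b
    simp [Matrix.mul_apply, Fintype.sum_prod_type, Matrix.one_apply, ite_and]
  constructor
  · ext a b
    have h0 := congrFun (congrFun (h 0) (⟨0, by omega⟩, a)) (⟨0, by omega⟩, b)
    simpa using h0
  · ext ⟨l, a⟩ ⟨m, b⟩
    have h0 := congrFun (congrFun (h (Matrix.of fun i j =>
      if i = (if j = ⟨0, by omega⟩ then l else m) then (1 : ℝ) else 0))
      (⟨0, by omega⟩, a)) (⟨1, by omega⟩, b)
    rw [Matrix.add_apply, Matrix.add_apply, entry, entry] at h0
    simpa [Matrix.one_apply] using h0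
end

section
/- Let 1 ≤ u ≤ r, Γ ∈ ℝ^{r×u} with Γ^TΓ = I_u, Ω ∈ ℝ^{u×u} symmetric positive definite, U ∈ ℝ^{r×N}, and X ∈ ℝ^{p×N} with XX^T invertible. Define F(β) = tr((U − βX)^T Γ Ω^{-1} Γ^T (U − βX)) for β ∈ ℝ^{r×p}, and let β̂ = Γ Γ^T U X^T (XX^T)^{-1}. Then F(β̂) ≤ F(β) for all β ∈ ℝ^{r×p}, and β̂ is the unique minimizer among all β satisfying β = ΓΓ^Tβ (i.e., with column span contained in the column span of Γ). -/
open Matrix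

lemma trace_quad_eq {u N : ℕ} (M : Matrix (Fin u) (Fin u) ℝ) (A : Matrix (Fin u) (Fin N) ℝ) :
    (Aᵀ * M * A).trace = ∑ j, (fun i => A i j) ⬝ᵥ (M *ᵥ (fun i => A i j)) := by
  unfold Matrix.trace
  refine Finset.sum_congr rfl fun j _ => ?_
  rw [Matrix.mul_assoc]
  rfl

lemma trace_quad_nonneg {u N : ℕ} {M : Matrix (Fin u) (Fin u) ℝ} (hM : M.PosDef)
    (A : Matrix (Fin u) (Fin N) ℝ) : 0 ≤ (Aᵀ * M * A).trace := by
  rw [trace_quad_eq]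
  refine Finset.sum_nonneg fun j _ => ?_
  simpa using hM.posSemidef.dotProduct_mulVec_nonneg (fun i => A i j)

lemma eq_zero_of_trace_quad {u N : ℕ} {M : Matrix (Fin u) (Fin u) ℝ} (hM : M.PosDef)
    (A : Matrix (Fin u) (Fin N) ℝ) (h : (Aᵀ * M * A).trace = 0) : A = 0 := by
  rw [trace_quad_eq, Finset.sum_eq_zero_iff_of_nonneg (fun j _ => by
    simpa using hM.posSemidef.dotProduct_mulVec_nonneg (fun i => A i j))] at h
  ext i j
  have hj := h j (Finset.mem_univ j)
  by_contra hne
  have hv : (fun i => A i j) ≠ 0 := fun h0 => hne (congrFun h0 i)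
  have := hM.dotProduct_mulVec_pos hv
  simp only [star_trivial] at this
  linarith

/-- **M-step update of the fixed-effect coefficient.** With `Γ` semi-orthogonal (`ΓᵀΓ = I_u`),
`Ω` symmetric positive definite, and `XXᵀ` invertible, the function
`F(β) = tr((U − βX)ᵀ Γ Ω⁻¹ Γᵀ (U − βX))` satisfies `F(β̂) ≤ F(β)` for all `β`, where
`β̂ = ΓΓᵀUXᵀ(XXᵀ)⁻¹`; moreover `β̂` is the unique minimizer among all `β` with
`β = ΓΓᵀβ`. -/
theorem fixed_effect_update_min
    (r u p N : ℕ) (hu1 : 1 ≤ u) (hur : u ≤ r)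
    (Γ : Matrix (Fin r) (Fin u) ℝ) (hΓ : Γᵀ * Γ = 1)
    (W : Matrix (Fin u) (Fin u) ℝ) (hW : W.PosDef)
    (U : Matrix (Fin r) (Fin N) ℝ) (X : Matrix (Fin p) (Fin N) ℝ)
    (hX : IsUnit (X * Xᵀ)) :
    let F : Matrix (Fin r) (Fin p) ℝ → ℝ :=
      fun β => ((U - β * X)ᵀ * Γ * W⁻¹ * Γᵀ * (U - β * X)).trace
    let βhat : Matrix (Fin r) (Fin p) ℝ := Γ * Γᵀ * U * Xᵀ * (X * Xᵀ)⁻¹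
    (∀ β, F βhat ≤ F β) ∧
    βhat = Γ * Γᵀ * βhat ∧
    (∀ β : Matrix (Fin r) (Fin p) ℝ, β = Γ * Γᵀ * β → F β = F βhat → β = βhat) := by
  intro F βhat
  have hM : (W⁻¹).PosDef := hW.inv
  have hdet : IsUnit (X * Xᵀ).det := (Matrix.isUnit_iff_isUnit_det _).1 hX
  have hG : ∀ {k : ℕ} (A : Matrix (Fin u) (Fin k) ℝ), Γᵀ * (Γ * A) = A := fun A => by
    rw [← Matrix.mul_assoc, hΓ, Matrix.one_mul]
  have hproj : βhat = Γ * Γᵀ * βhat := by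
    simp only [βhat, Matrix.mul_assoc, hG]
  have hR : Γᵀ * (U - βhat * X) * Xᵀ = 0 := by
    have h1 : βhat * X * Xᵀ = Γ * Γᵀ * U * Xᵀ := by
      simp only [βhat]
      rw [Matrix.mul_assoc _ X Xᵀ, Matrix.nonsing_inv_mul_cancel_right _ _ hdet]
    rw [Matrix.mul_assoc, Matrix.sub_mul, h1, Matrix.mul_sub]
    simp only [Matrix.mul_assoc, hG, sub_self]
  have key : ∀ β, F β = F βhat +
      ((Γᵀ * (βhat - β) * X)ᵀ * W⁻¹ * (Γᵀ * (βhat - β) * X)).trace := by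
    intro β
    have hF : ∀ β, F β = ((Γᵀ * (U - β * X))ᵀ * W⁻¹ * (Γᵀ * (U - β * X))).trace := by
      intro β
      simp only [F, Matrix.transpose_mul, Matrix.transpose_transpose, Matrix.mul_assoc]
    have hs : Γᵀ * (U - β * X) = Γᵀ * (U - βhat * X) + Γᵀ * (βhat - β) * X := by
      simp only [Matrix.mul_sub, Matrix.sub_mul, Matrix.mul_assoc]
      abel
    rw [hF β, hF βhat, hs]
    generalize Γᵀ * (U - βhat * X) = R at hR
    generalize Γᵀ * (βhat - β) = D
    have hR' : X * Rᵀ = 0 := by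
      have := congrArg Matrix.transpose hR
      simpa [Matrix.transpose_mul] using this
    have c1 : (Rᵀ * W⁻¹ * (D * X)).trace = 0 := by
      rw [← Matrix.mul_assoc, Matrix.trace_mul_comm, ← Matrix.mul_assoc, ← Matrix.mul_assoc, hR']
      simp
    have c2 : ((D * X)ᵀ * W⁻¹ * R).trace = 0 := by
      rw [Matrix.transpose_mul, Matrix.trace_mul_comm, Matrix.mul_assoc, ← Matrix.mul_assoc R, hR]
      simp
    rw [Matrix.transpose_add, Matrix.add_mul, Matrix.add_mul, Matrix.mul_add, Matrix.mul_add,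
      Matrix.trace_add, Matrix.trace_add, Matrix.trace_add, c1, c2]
    ring
  refine ⟨fun β => ?_, hproj, fun β hβ hFβ => ?_⟩
  · rw [key β]
    linarith [trace_quad_nonneg hM (Γᵀ * (βhat - β) * X)]
  · have h0 := eq_zero_of_trace_quad hM (Γᵀ * (βhat - β) * X) (by linarith [key β])
    have h1 : Γᵀ * (βhat - β) = 0 := by
      rw [← Matrix.mul_nonsing_inv_cancel_right (X * Xᵀ) (Γᵀ * (βhat - β)) hdet,
        ← Matrix.mul_assoc (Γᵀ * (βhat - β)) X Xᵀ, h0]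
      simp
    have h2 : Γ * Γᵀ * βhat - Γ * Γᵀ * β = 0 := by
      rw [← Matrix.mul_sub, Matrix.mul_assoc, h1, Matrix.mul_zero]
    rw [← hproj, ← hβ] at h2
    exact (sub_eq_zero.1 h2).symm
end
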